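/- arXiv:2310.04849 — 5 statements merged into one kernel-verified Lean document; each statement's English description precedes it below -/
import Mathlib

section
/- Fix an integer n ≥ 1 and an n×n matrix E with rational entries such that B := E − Eᵀ is invertible over ℚ, and set Λ := B⁻¹ (which is skew-symmetric). For column vectors m, e ∈ ℚⁿ define p(m,e) := −Eᵀe − E(m−e) = Be − Em. Then for all e, f, m, n ∈ ℚⁿ one has p(m,e)ᵀ Λ p(n,f) = (Em)ᵀΛ(En) + eᵀE(n−f) − fᵀE(m−e). -/
open Matrix

/-- The exponent `-Eᵀe - E(m - e)` equals `Be - Em`, where `B = E - Eᵀ`. -/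
lemma exponent_eq_sub {ι R : Type*} [Fintype ι] [CommRing R] (E : Matrix ι ι R) (m e : ι → R) :
    -(Eᵀ *ᵥ e) - E *ᵥ (m - e) = (E - Eᵀ) *ᵥ e - E *ᵥ m := by
  rw [mulVec_sub, sub_mulVec]
  abel

/-- A skew-symmetric matrix `B` with right inverse `Λ` satisfies `(Bx)ᵀ Λ y = -xᵀy`. -/
lemma mulVec_dotProduct_mulVec_of_skew {ι R : Type*} [Fintype ι] [DecidableEq ι] [CommRing R]
    {B Λ : Matrix ι ι R} (hskew : Bᵀ = -B) (hmul : B * Λ = 1) (x y : ι → R) :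
    (B *ᵥ x) ⬝ᵥ (Λ *ᵥ y) = -(x ⬝ᵥ y) := by
  rw [← vecMul_transpose, hskew, ← dotProduct_mulVec, mulVec_mulVec, neg_mul, hmul, neg_mulVec,
    one_mulVec, dotProduct_neg]

/-- Lemma 4.9 (Chen–Ding–Zhang, Lemma 7.2): with `B := E − Eᵀ` invertible, `Λ := B⁻¹`, and
`p(m,e) := −Eᵀe − E(m−e)`, one has
`p(m,e)ᵀ Λ p(n,f) = (Em)ᵀ Λ (En) + eᵀE(n−f) − fᵀE(m−e)`. -/
theorem stmt5 (n : ℕ) (hn : 1 ≤ n) (E : Matrix (Fin n) (Fin n) ℚ)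
    (hB : IsUnit (E - Eᵀ)) (Λ : Matrix (Fin n) (Fin n) ℚ) (hΛ : Λ = (E - Eᵀ)⁻¹)
    (e f m nn : Fin n → ℚ) :
    (-(Eᵀ *ᵥ e) - E *ᵥ (m - e)) ⬝ᵥ (Λ *ᵥ (-(Eᵀ *ᵥ f) - E *ᵥ (nn - f))) =
      (E *ᵥ m) ⬝ᵥ (Λ *ᵥ (E *ᵥ nn)) + e ⬝ᵥ (E *ᵥ (nn - f)) - f ⬝ᵥ (E *ᵥ (m - e)) := by
  have hdet : IsUnit (E - Eᵀ).det := (isUnit_iff_isUnit_det _).mp hB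
  have hmul : (E - Eᵀ) * Λ = 1 := hΛ ▸ mul_nonsing_inv _ hdet
  have hmul' : Λ * (E - Eᵀ) = 1 := hΛ ▸ nonsing_inv_mul _ hdet
  have hskew : (E - Eᵀ)ᵀ = -(E - Eᵀ) := by simp
  have hEf : f ⬝ᵥ (Eᵀ *ᵥ e) = e ⬝ᵥ (E *ᵥ f) := by
    rw [dotProduct_mulVec, vecMul_transpose, dotProduct_comm]
  rw [exponent_eq_sub, exponent_eq_sub, mulVec_sub Λ, mulVec_mulVec, hmul', one_mulVec,
    sub_dotProduct, dotProduct_sub, dotProduct_sub, mulVec_dotProduct_mulVec_of_skew hskew hmul,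
    dotProduct_comm _ f, dotProduct_comm _ f, sub_mulVec]
  simp only [mulVec_sub, dotProduct_sub, hEf]
  ring
end

section
/- Fix an integer n ≥ 1 and an n×n matrix E with rational entries such that B := E − Eᵀ is invertible over ℚ, and set Λ := B⁻¹ (which is skew-symmetric). Let m, n, a, d, i ∈ ℚⁿ be column vectors satisfying E(d − i − n) = Eᵀ(m − a). Then (Eᵀ(m−a))ᵀ Λ (Eᵀ(n+a)) + (m−a)ᵀE n + (Eᵀa)ᵀ Λ (Eᵀ(d−i)) = (Eᵀm)ᵀ Λ (Eᵀn) + (m−a)ᵀE(n−a). -/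
open Matrix

/-- A matrix with `Aᵀ = -A` defines an antisymmetric bilinear form. -/
theorem Matrix.dotProduct_mulVec_of_transpose_eq_neg {ι R : Type*} [Fintype ι] [CommRing R]
    {A : Matrix ι ι R} (hA : Aᵀ = -A) (x y : ι → R) :
    x ⬝ᵥ (A *ᵥ y) = -(y ⬝ᵥ (A *ᵥ x)) := by
  rw [dotProduct_mulVec, ← mulVec_transpose, hA, neg_mulVec, neg_dotProduct, dotProduct_comm]

/-- Chen–Ding–Zhang, Lemma 7.3: with `B := E − Eᵀ` invertible, `Λ := B⁻¹`, and vectors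
satisfying `E(d − i − n) = Eᵀ(m − a)`, one has
`Λ((m−a)*, (n+a)*) + ⟨m−a, n⟩ + Λ(a*, (d−i)*) = Λ(m*, n*) + ⟨m−a, n−a⟩`. -/
theorem stmt6 (n : ℕ) (hn : 1 ≤ n) (E : Matrix (Fin n) (Fin n) ℚ)
    (hB : IsUnit (E - Eᵀ)) (Λ : Matrix (Fin n) (Fin n) ℚ) (hΛ : Λ = (E - Eᵀ)⁻¹)
    (m nn a d i : Fin n → ℚ)
    (hrel : E *ᵥ (d - i - nn) = Eᵀ *ᵥ (m - a)) :
    (Eᵀ *ᵥ (m - a)) ⬝ᵥ (Λ *ᵥ (Eᵀ *ᵥ (nn + a))) + (m - a) ⬝ᵥ (E *ᵥ nn) +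
        (Eᵀ *ᵥ a) ⬝ᵥ (Λ *ᵥ (Eᵀ *ᵥ (d - i))) =
      (Eᵀ *ᵥ m) ⬝ᵥ (Λ *ᵥ (Eᵀ *ᵥ nn)) + (m - a) ⬝ᵥ (E *ᵥ (nn - a)) := by
  have hdet : IsUnit (E - Eᵀ).det := (isUnit_iff_isUnit_det _).mp hB
  have hΛB : Λ * (E - Eᵀ) = 1 := by rw [hΛ, nonsing_inv_mul _ hdet]
  have hskew : Λᵀ = -Λ := by
    rw [hΛ, transpose_nonsing_inv, transpose_sub, transpose_transpose, ← neg_sub E Eᵀ]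
    refine inv_eq_left_inv ?_
    rw [neg_mul_neg, nonsing_inv_mul _ hdet]
  have htau : Eᵀ *ᵥ (d - i - nn) = Eᵀ *ᵥ (m - a) - (E - Eᵀ) *ᵥ (d - i - nn) := by
    rw [sub_mulVec, hrel, sub_sub_cancel]
  have hpair : (Eᵀ *ᵥ a) ⬝ᵥ (d - i - nn) = (m - a) ⬝ᵥ (E *ᵥ a) := by
    rw [mulVec_transpose, ← dotProduct_mulVec, hrel, mulVec_transpose, dotProduct_comm,
      ← dotProduct_mulVec]
  have hkey : (Eᵀ *ᵥ a) ⬝ᵥ (Λ *ᵥ (Eᵀ *ᵥ (d - i - nn))) =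
      -((Eᵀ *ᵥ (m - a)) ⬝ᵥ (Λ *ᵥ (Eᵀ *ᵥ a))) - (m - a) ⬝ᵥ (E *ᵥ a) := by
    rw [htau, mulVec_sub, mulVec_mulVec _ Λ (E - Eᵀ), hΛB, one_mulVec, dotProduct_sub, hpair,
      dotProduct_mulVec_of_transpose_eq_neg hskew]
  simp only [mulVec_sub, mulVec_add, dotProduct_sub, dotProduct_add, sub_dotProduct] at hkey ⊢
  linarith
end

section
/- Fix an integer n ≥ 1 and an n×n matrix E with rational entries such that B := E − Eᵀ is invertible over ℚ, and set Λ := (Eᵀ − E)⁻¹ = −B⁻¹ (which is skew-symmetric). Let p, i ∈ ℚⁿ be column vectors with Eᵀp = Ei. Then for all column vectors e, m ∈ ℚⁿ one has (−Eᵀe − E(m−e))ᵀ Λ (Ei) − eᵀE(m−e) − (p−e)ᵀE(m−e) = (Ei)ᵀ Λ (Em) − (m−2e)ᵀE i. -/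
open Matrix

/-- Exponent computation of Lemma 4.15: with `B := E − Eᵀ` invertible,
`Λ := (Eᵀ − E)⁻¹ = −B⁻¹`, and `Eᵀp = Ei` (i.e. `p* = *i`), one has
`Λ(−e* − *(m−e), *i) − ⟨e, m−e⟩ − ⟨p−e, m−e⟩ = Λ(*i, *m) − ⟨m−2e, i⟩`. -/
theorem stmt8 (n : ℕ) (hn : 1 ≤ n) (E : Matrix (Fin n) (Fin n) ℚ)
    (hB : IsUnit (E - Eᵀ)) (Λ : Matrix (Fin n) (Fin n) ℚ) (hΛ : Λ = (Eᵀ - E)⁻¹)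
    (p i : Fin n → ℚ) (hpi : Eᵀ *ᵥ p = E *ᵥ i) (e m : Fin n → ℚ) :
    (-(Eᵀ *ᵥ e) - E *ᵥ (m - e)) ⬝ᵥ (Λ *ᵥ (E *ᵥ i)) - e ⬝ᵥ (E *ᵥ (m - e)) -
        (p - e) ⬝ᵥ (E *ᵥ (m - e)) =
      (E *ᵥ i) ⬝ᵥ (Λ *ᵥ (E *ᵥ m)) - (m - 2 • e) ⬝ᵥ (E *ᵥ i) := by
  set S := Eᵀ - E with hS
  set w := E *ᵥ i
  have hSt : Sᵀ = -S := by simp [hS]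
  have hS_unit : IsUnit S.det := by
    rw [← isUnit_iff_isUnit_det, hS, ← neg_sub E Eᵀ]
    exact hB.neg
  have hΛt : Λᵀ = -Λ := by
    rw [hΛ, transpose_nonsing_inv, hSt]
    exact inv_eq_right_inv (by rw [neg_mul_neg, mul_nonsing_inv S hS_unit])
  have h_skew : (E *ᵥ m) ⬝ᵥ (Λ *ᵥ w) = -(w ⬝ᵥ (Λ *ᵥ (E *ᵥ m))) := by
    rw [dotProduct_mulVec, ← mulVec_transpose, hΛt, neg_mulVec, neg_dotProduct, dotProduct_comm]
  have h_cancel : (S *ᵥ e) ⬝ᵥ (Λ *ᵥ w) = -(e ⬝ᵥ w) := by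
    rw [← vecMul_transpose, ← dotProduct_mulVec, mulVec_mulVec, hSt, hΛ, neg_mul,
      mul_nonsing_inv S hS_unit, neg_mulVec, one_mulVec, dotProduct_neg]
  have h_proj : p ⬝ᵥ (E *ᵥ (m - e)) = m ⬝ᵥ w - e ⬝ᵥ w := by
    rw [dotProduct_mulVec, ← mulVec_transpose, hpi, dotProduct_comm, sub_dotProduct]
  have h_split : -(Eᵀ *ᵥ e) - E *ᵥ (m - e) = -(E *ᵥ m) - S *ᵥ e := by
    rw [hS, mulVec_sub, sub_mulVec]
    abel
  rw [h_split, sub_dotProduct, neg_dotProduct, h_skew, h_cancel, sub_dotProduct p, h_proj,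
    sub_dotProduct, smul_dotProduct, nsmul_eq_mul]
  push_cast
  ring
end

section
/- Fix an integer n ≥ 1 and an n×n matrix E with rational entries such that B := E − Eᵀ is invertible over ℚ, and set Λ := B⁻¹ (which is skew-symmetric). Then for all column vectors e, f, m, n ∈ ℚⁿ one has (−Eᵀe − E(m−e))ᵀ Λ (−Eᵀf − E(n−f)) − eᵀE(m−e) − fᵀE(n−f) + (e+f)ᵀE(m+n−e−f) = (Eᵀm)ᵀ Λ (Eᵀn) + 2·eᵀE(n−f). -/
open Matrix

/-- For a skew-symmetric invertible matrix `B`, moving `B` across the pairing given by `B⁻¹`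
changes the sign. -/
theorem mulVec_dotProduct_inv_mulVec_of_skew {ι R : Type*} [Fintype ι] [DecidableEq ι]
    [CommRing R] {B : Matrix ι ι R} (hB : IsUnit B) (hskew : Bᵀ = -B) (x y : ι → R) :
    (B *ᵥ x) ⬝ᵥ (B⁻¹ *ᵥ y) = -(x ⬝ᵥ y) := by
  have hdet := (Matrix.isUnit_iff_isUnit_det B).mp hB
  rw [← vecMul_transpose, ← dotProduct_mulVec, hskew, neg_mulVec, mulVec_mulVec,
    mul_nonsing_inv B hdet, one_mulVec, dotProduct_neg]

/-- The pairing given by the inverse of `E - Eᵀ` takes the same values on the images of `E`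
and of `Eᵀ`. -/
theorem mulVec_dotProduct_inv_sub_transpose {ι R : Type*} [Fintype ι] [DecidableEq ι]
    [CommRing R] {E : Matrix ι ι R} (hB : IsUnit (E - Eᵀ)) (x y : ι → R) :
    (E *ᵥ x) ⬝ᵥ ((E - Eᵀ)⁻¹ *ᵥ (E *ᵥ y)) = (Eᵀ *ᵥ x) ⬝ᵥ ((E - Eᵀ)⁻¹ *ᵥ (Eᵀ *ᵥ y)) := by
  have hskew : (E - Eᵀ)ᵀ = -(E - Eᵀ) := by simp
  have hdet := (Matrix.isUnit_iff_isUnit_det _).mp hB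
  have hright : (Eᵀ *ᵥ x) ⬝ᵥ ((E - Eᵀ)⁻¹ *ᵥ ((E - Eᵀ) *ᵥ y)) = x ⬝ᵥ (E *ᵥ y) := by
    rw [mulVec_mulVec, nonsing_inv_mul _ hdet, one_mulVec, mulVec_transpose,
      ← dotProduct_mulVec]
  have hleft := mulVec_dotProduct_inv_mulVec_of_skew hB hskew x (E *ᵥ y)
  simp only [sub_mulVec E, mulVec_sub, sub_dotProduct, dotProduct_sub] at hleft hright
  linear_combination hleft + hright

/-- Exponent computation preceding Corollary 4.11: with `B := E − Eᵀ` invertible and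
`Λ := B⁻¹`, one has
`Λ(p(m,e), p(n,f)) − ⟨e,m−e⟩ − ⟨f,n−f⟩ + ⟨e+f, m+n−e−f⟩ = Λ(m*, n*) + 2⟨e, n−f⟩`. -/
theorem stmt9 (n : ℕ) (hn : 1 ≤ n) (E : Matrix (Fin n) (Fin n) ℚ)
    (hB : IsUnit (E - Eᵀ)) (Λ : Matrix (Fin n) (Fin n) ℚ) (hΛ : Λ = (E - Eᵀ)⁻¹)
    (e f m nn : Fin n → ℚ) :
    (-(Eᵀ *ᵥ e) - E *ᵥ (m - e)) ⬝ᵥ (Λ *ᵥ (-(Eᵀ *ᵥ f) - E *ᵥ (nn - f))) -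
        e ⬝ᵥ (E *ᵥ (m - e)) - f ⬝ᵥ (E *ᵥ (nn - f)) +
        (e + f) ⬝ᵥ (E *ᵥ (m + nn - e - f)) =
      (Eᵀ *ᵥ m) ⬝ᵥ (Λ *ᵥ (Eᵀ *ᵥ nn)) + 2 * (e ⬝ᵥ (E *ᵥ (nn - f))) := by
  subst hΛ
  have hskew : (E - Eᵀ)ᵀ = -(E - Eᵀ) := by simp
  have hdet := (Matrix.isUnit_iff_isUnit_det _).mp hB
  have hp (x y : Fin n → ℚ) : -(Eᵀ *ᵥ x) - E *ᵥ (y - x) = (E - Eᵀ) *ᵥ x - E *ᵥ y := by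
    rw [sub_mulVec, mulVec_sub]
    abel
  have hinv : (E - Eᵀ)⁻¹ *ᵥ ((E - Eᵀ) *ᵥ f) = f := by
    rw [mulVec_mulVec, nonsing_inv_mul _ hdet, one_mulVec]
  rw [hp e m, hp f nn, mulVec_sub (E - Eᵀ)⁻¹, hinv, sub_dotProduct, dotProduct_sub,
    dotProduct_sub, mulVec_dotProduct_inv_mulVec_of_skew hB hskew,
    mulVec_dotProduct_inv_sub_transpose hB, dotProduct_comm _ f, dotProduct_comm (E *ᵥ m) f]
  simp only [sub_mulVec E, mulVec_sub, mulVec_add, dotProduct_sub, dotProduct_add,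
    add_dotProduct]
  have htranspose : f ⬝ᵥ (Eᵀ *ᵥ e) = e ⬝ᵥ (E *ᵥ f) := by
    rw [mulVec_transpose, dotProduct_comm, ← dotProduct_mulVec]
  linear_combination -htranspose
end

section
/- Fix an integer n ≥ 1 and an n×n matrix E with rational entries. Let m, n, a, d, i, e, f ∈ ℚⁿ be column vectors satisfying E(d − i − n) = Eᵀ(m − a), and set u := e − (m − a) and v := f. Then (m−a)ᵀE(n−a) + 2·uᵀE((d−i) − v) − (u+v)ᵀE((a + d − i) − (u+v)) = 2·eᵀE(n−f) − (e+f)ᵀE((m+n) − (e+f)). -/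
open Matrix

/-- Euler-form computation in the proof of Corollary 4.20: if `E(d − i − n) = Eᵀ(m − a)` and
`u := e − (m − a)`, `v := f`, then
`⟨m−a, n−a⟩ + 2⟨u, d−i−v⟩ − ⟨u+v, a+d−i−u−v⟩ = 2⟨e, n−f⟩ − ⟨e+f, m+n−e−f⟩`. -/
theorem stmt10 (n : ℕ) (hn : 1 ≤ n) (E : Matrix (Fin n) (Fin n) ℚ)
    (m nn a d i e f u v : Fin n → ℚ)
    (hrel : E *ᵥ (d - i - nn) = Eᵀ *ᵥ (m - a))
    (hu : u = e - (m - a)) (hv : v = f) :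
    (m - a) ⬝ᵥ (E *ᵥ (nn - a)) + 2 * (u ⬝ᵥ (E *ᵥ ((d - i) - v))) -
        (u + v) ⬝ᵥ (E *ᵥ ((a + d - i) - (u + v))) =
      2 * (e ⬝ᵥ (E *ᵥ (nn - f))) - (e + f) ⬝ᵥ (E *ᵥ ((m + nn) - (e + f))) := by
  subst hu hv
  have hpair : ∀ x : Fin n → ℚ, x ⬝ᵥ (E *ᵥ (d - i - nn)) = (m - a) ⬝ᵥ (E *ᵥ x) := fun x ↦ by
    rw [hrel, mulVec_transpose, dotProduct_comm, dotProduct_mulVec]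
  have h := hpair (e - v - (m - a))
  simp only [mulVec_sub, mulVec_add, dotProduct_sub, dotProduct_add, sub_dotProduct,
    add_dotProduct] at h ⊢
  linear_combination h
end
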